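/- Assume n ≥ 3, 0 ≤ a < (n−2)/2, a ≤ b < a+1 and p = 2n/(n−2+2(b−a)), and let ζ be a positive periodic solution of (Z) with associated exponents {σ_i}_{i≥1}. Let γ > 0 be a constant, m ≥ 0 an integer, and h a smooth periodic function with the same period as ζ. Then for every i ≥ 0 the ODE 𝓛_i φ = t^m e^{−γ t} h(t) has a particular solution φ_* of the form: φ_*(t) = e^{−γ t} Σ_{j=0}^{m} t^j r_j(t) if γ ≠ σ_i, and φ_*(t) = e^{−γ t} Σ_{j=0}^{m+1} t^j r_j(t) if γ = σ_i, where r_0, ..., r_{m+1} are smooth periodic functions with the same period as ζ. -/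

import Mathlib

open Real Set Metric Filter Function

noncomputable section

/-- The Euclidean Laplacian of `f` at `x`. -/
def lapE {n : ℕ} (f : EuclideanSpace ℝ (Fin n) → ℝ) (x : EuclideanSpace ℝ (Fin n)) : ℝ :=
  ∑ i : Fin n, iteratedFDeriv ℝ 2 f x ![EuclideanSpace.single i 1, EuclideanSpace.single i 1]

/-- The Laplace–Beltrami operator `Δ_θ` on the unit sphere `S^{n-1}`, computed via the
degree-zero homogeneous extension: for `θ` with `‖θ‖ = 1`, `sphLap f θ = Δ_θ f (θ)`. -/
def sphLap {n : ℕ} (f : EuclideanSpace ℝ (Fin n) → ℝ) (θ : EuclideanSpace ℝ (Fin n)) : ℝ :=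
  lapE (fun x => f (‖x‖⁻¹ • x)) θ

/-- Second derivative in the `t` variable. -/
def dtt (g : ℝ → ℝ) : ℝ → ℝ := deriv (deriv g)

/-- Dimension of the space of spherical harmonics on `S^{n-1}` of degree at most `d`. -/
def cumHarm (n d : ℕ) : ℕ := Nat.choose (n - 1 + d) (n - 1) + Nat.choose (n - 2 + d) (n - 1)

/-- The degree of the `i`-th spherical harmonic, eigenfunctions being listed with multiplicity. -/
def sphDeg (n i : ℕ) : ℕ := sInf {d | i < cumHarm n d}

/-- The `i`-th eigenvalue `λ_i` of `-Δ_θ` on `S^{n-1}`, listed in increasing order and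
repeated with multiplicity: `λ_i = d (n + d - 2)` where `d` is the degree of the `i`-th
spherical harmonic.  In particular `λ_0 = 0`, `λ_1 = ⋯ = λ_n = n - 1`, `λ_{n+1} = 2n`. -/
def sphEval (n i : ℕ) : ℝ := (sphDeg n i : ℝ) * ((n : ℝ) + (sphDeg n i : ℝ) - 2)

/-- The linearized operator `L_i = -d²/dt² + λ + (n-2)²/4 - ((n+2)/(n-2)) K(0) ξ^{4/(n-2)}`. -/
def Lop (n : ℕ) (K0 : ℝ) (ξ : ℝ → ℝ) (lam : ℝ) (h : ℝ → ℝ) : ℝ → ℝ :=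
  fun t => -dtt h t
    + (lam + ((n : ℝ) - 2) ^ 2 / 4
        - ((n : ℝ) + 2) / ((n : ℝ) - 2) * K0 * ξ t ^ ((4 : ℝ) / ((n : ℝ) - 2))) * h t

/-- The linearized operator `𝓛_i = -d²/dt² + λ + (n-2a-2)²/4 - (p-1) ζ^{p-2}` for the
Caffarelli-Kohn-Nirenberg equation. -/
def LopCKN (n : ℕ) (a p : ℝ) (ζ : ℝ → ℝ) (lam : ℝ) (h : ℝ → ℝ) : ℝ → ℝ :=
  fun t => -dtt h t + (lam + ((n : ℝ) - 2 * a - 2) ^ 2 / 4 - (p - 1) * ζ t ^ (p - 2)) * h t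

/-- `f, g` is a basis of the kernel of the second-order ODE operator `L` acting on `C²(ℝ)`. -/
def KerBasis (L : (ℝ → ℝ) → ℝ → ℝ) (f g : ℝ → ℝ) : Prop :=
  ContDiff ℝ 2 f ∧ ContDiff ℝ 2 g ∧ (∀ t, L f t = 0) ∧ (∀ t, L g t = 0) ∧
    LinearIndependent ℝ ![f, g] ∧
    ∀ h : ℝ → ℝ, ContDiff ℝ 2 h → (∀ t, L h t = 0) →
      ∃ c₁ c₂ : ℝ, ∀ t, h t = c₁ * f t + c₂ * g t

/-- `ξ` is a positive `T`-periodic solution of the Fowler equation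
`-ξ'' + ((n-2)²/4) ξ = K(0) ξ^{(n+2)/(n-2)}` on `ℝ`. -/
def FowlerXi (n : ℕ) (K0 : ℝ) (ξ : ℝ → ℝ) (T : ℝ) : Prop :=
  ContDiff ℝ 2 ξ ∧ (∀ t, 0 < ξ t) ∧ 0 < T ∧ Function.Periodic ξ T ∧
    ∀ t, -dtt ξ t + ((n : ℝ) - 2) ^ 2 / 4 * ξ t = K0 * ξ t ^ (((n : ℝ) + 2) / ((n : ℝ) - 2))

/-- `ζ` is a positive `T`-periodic solution of `-ζ'' + ((n-2a-2)²/4) ζ = ζ^{p-1}` on `ℝ`. -/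
def ZetaSol (n : ℕ) (a p : ℝ) (ζ : ℝ → ℝ) (T : ℝ) : Prop :=
  ContDiff ℝ 2 ζ ∧ (∀ t, 0 < ζ t) ∧ 0 < T ∧ Function.Periodic ζ T ∧
    ∀ t, -dtt ζ t + ((n : ℝ) - 2 * a - 2) ^ 2 / 4 * ζ t = ζ t ^ (p - 1)

/-- `ρ` is the increasing, divergent sequence of positive exponents such that, for every
`i ≥ 1`, the kernel of the linearized operator `L_i` at the Fowler solution `ξ` has a basis
`e^{-ρ_i t} p_i⁺(t)`, `e^{ρ_i t} p_i⁻(t)` with `p_i^±` smooth and `T`-periodic. -/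
def FowlerExponents (n : ℕ) (K0 : ℝ) (ξ : ℝ → ℝ) (T : ℝ) (ρ : ℕ → ℝ) : Prop :=
  (∀ i, 1 ≤ i → 0 < ρ i) ∧ (∀ i j, 1 ≤ i → i ≤ j → ρ i ≤ ρ j) ∧
    Tendsto ρ atTop atTop ∧
    ∀ i, 1 ≤ i → ∃ p₁ p₂ : ℝ → ℝ, ContDiff ℝ (⊤ : ℕ∞) p₁ ∧ ContDiff ℝ (⊤ : ℕ∞) p₂ ∧
      Function.Periodic p₁ T ∧ Function.Periodic p₂ T ∧
      KerBasis (Lop n K0 ξ (sphEval n i))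
        (fun t => Real.exp (-(ρ i) * t) * p₁ t) (fun t => Real.exp (ρ i * t) * p₂ t)

/-- Analogue of `FowlerExponents` for the CKN linearized operators `𝓛_i`. -/
def CKNExponents (n : ℕ) (a p : ℝ) (ζ : ℝ → ℝ) (T : ℝ) (σ : ℕ → ℝ) : Prop :=
  (∀ i, 1 ≤ i → 0 < σ i) ∧ (∀ i j, 1 ≤ i → i ≤ j → σ i ≤ σ j) ∧
    Tendsto σ atTop atTop ∧
    ∀ i, 1 ≤ i → ∃ q₁ q₂ : ℝ → ℝ, ContDiff ℝ (⊤ : ℕ∞) q₁ ∧ ContDiff ℝ (⊤ : ℕ∞) q₂ ∧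
      Function.Periodic q₁ T ∧ Function.Periodic q₂ T ∧
      KerBasis (LopCKN n a p ζ (sphEval n i))
        (fun t => Real.exp (-(σ i) * t) * q₁ t) (fun t => Real.exp (σ i * t) * q₂ t)

/-- The index set `{ Σ_{i≥1} nᵢ ρᵢ > 0 : nᵢ ∈ ℕ, finitely many nᵢ > 0 }`. -/
def IndexSet (ρ : ℕ → ℝ) : Set ℝ :=
  {s | 0 < s ∧ ∃ f : ℕ →₀ ℕ, (∀ i ∈ f.support, 1 ≤ i) ∧
    s = ∑ i ∈ f.support, (f i : ℝ) * ρ i}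

/-- `v` is a positive solution on `(t₀, ∞) × S^{n-1}` of the cylindrical conformal scalar
curvature equation `-v_tt - Δ_θ v + ((n-2)²/4) v = K(e^{-t}θ) v^{(n+2)/(n-2)}`. -/
def SolCyl (n : ℕ) (K : EuclideanSpace ℝ (Fin n) → ℝ)
    (v : ℝ → EuclideanSpace ℝ (Fin n) → ℝ) (t₀ : ℝ) : Prop :=
  (∀ t θ, t₀ < t → ‖θ‖ = 1 → 0 < v t θ) ∧
    ∀ (t : ℝ) (θ : EuclideanSpace ℝ (Fin n)), t₀ < t → ‖θ‖ = 1 →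
      -dtt (fun s => v s θ) t - sphLap (v t) θ + ((n : ℝ) - 2) ^ 2 / 4 * v t θ
        = K (Real.exp (-t) • θ) * v t θ ^ (((n : ℝ) + 2) / ((n : ℝ) - 2))

/-- `w` is a positive solution on `(t₀, ∞) × S^{n-1}` of the cylindrical CKN equation
`-w_tt - Δ_θ w + ((n-2a-2)²/4) w = w^{p-1}`. -/
def SolCylW (n : ℕ) (a p : ℝ) (w : ℝ → EuclideanSpace ℝ (Fin n) → ℝ) (t₀ : ℝ) : Prop :=
  (∀ t θ, t₀ < t → ‖θ‖ = 1 → 0 < w t θ) ∧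
    ∀ (t : ℝ) (θ : EuclideanSpace ℝ (Fin n)), t₀ < t → ‖θ‖ = 1 →
      -dtt (fun s => w s θ) t - sphLap (w t) θ + ((n : ℝ) - 2 * a - 2) ^ 2 / 4 * w t θ
        = w t θ ^ (p - 1)

/-- `v(t, θ) → ξ(t)` as `t → ∞`, uniformly for `θ ∈ S^{n-1}`. -/
def UnifConv {n : ℕ} (v : ℝ → EuclideanSpace ℝ (Fin n) → ℝ) (ξ : ℝ → ℝ) : Prop :=
  ∀ ε > 0, ∃ T : ℝ, ∀ t ≥ T, ∀ θ : EuclideanSpace ℝ (Fin n), ‖θ‖ = 1 → |v t θ - ξ t| < ε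

/-- The degree-zero homogeneous (in the sphere variable) representative of a function on the
cylinder `ℝ × S^{n-1}`. -/
def cylRep {n : ℕ} (F : ℝ → EuclideanSpace ℝ (Fin n) → ℝ) :
    ℝ × EuclideanSpace ℝ (Fin n) → ℝ :=
  fun pt => F pt.1 (‖pt.2‖⁻¹ • pt.2)

/-- The norm of the intrinsic gradient on the cylinder `ℝ × S^{n-1}` at `(t, θ)`. -/
def cylGrad {n : ℕ} (F : ℝ → EuclideanSpace ℝ (Fin n) → ℝ) (t : ℝ)
    (θ : EuclideanSpace ℝ (Fin n)) : ℝ :=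
  ‖fderiv ℝ (cylRep F) (t, θ)‖

/-- Membership in `C^{2,α}` of a region `s` of the cylinder. -/
def CylC2Holder {n : ℕ} (α : ℝ) (s : Set (ℝ × EuclideanSpace ℝ (Fin n)))
    (F : ℝ → EuclideanSpace ℝ (Fin n) → ℝ) : Prop :=
  ContDiffOn ℝ 2 (cylRep F) s ∧
    ∃ C : ℝ, ∀ p ∈ s, ∀ q ∈ s,
      ‖iteratedFDerivWithin ℝ 2 (cylRep F) s p - iteratedFDerivWithin ℝ 2 (cylRep F) s q‖
        ≤ C * ‖p - q‖ ^ α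

/-- A bounded smooth function on `(t₀, ∞) × S^{n-1}`. -/
def BddSmoothCyl {n : ℕ} (t₀ : ℝ) (c : ℝ → EuclideanSpace ℝ (Fin n) → ℝ) : Prop :=
  ContDiffOn ℝ (⊤ : ℕ∞) (cylRep c)
      ((Ioi t₀) ×ˢ {x : EuclideanSpace ℝ (Fin n) | x ≠ 0}) ∧
    ∃ M : ℝ, ∀ t θ, t₀ < t → ‖θ‖ = 1 → |c t θ| ≤ M

/-- The nonlinear operator `𝓜(f) = -f_tt - Δ_θ f + ((n-2)²/4) f - K f^{(n+2)/(n-2)}`. -/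
def Mop (n : ℕ) (K : EuclideanSpace ℝ (Fin n) → ℝ)
    (f : ℝ → EuclideanSpace ℝ (Fin n) → ℝ) (t : ℝ) (θ : EuclideanSpace ℝ (Fin n)) : ℝ :=
  -dtt (fun s => f s θ) t - sphLap (f t) θ + ((n : ℝ) - 2) ^ 2 / 4 * f t θ
    - K (Real.exp (-t) • θ) * f t θ ^ (((n : ℝ) + 2) / ((n : ℝ) - 2))

/-- The nonlinear operator `𝓝(f) = -f_tt - Δ_θ f + ((n-2a-2)²/4) f - f^{p-1}`. -/
def Nop (n : ℕ) (a p : ℝ)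
    (f : ℝ → EuclideanSpace ℝ (Fin n) → ℝ) (t : ℝ) (θ : EuclideanSpace ℝ (Fin n)) : ℝ :=
  -dtt (fun s => f s θ) t - sphLap (f t) θ + ((n : ℝ) - 2 * a - 2) ^ 2 / 4 * f t θ
    - f t θ ^ (p - 1)

/-- smooth and `T`-periodic -/
def SP {E : Type*} [NormedAddCommGroup E] [NormedSpace ℝ E] (T : ℝ) (f : ℝ → E) : Prop :=
  ContDiff ℝ (⊤ : ℕ∞) f ∧ Function.Periodic f T

/-- polynomials of degree at most `m` with smooth periodic coefficients -/
def QP {E : Type*} [NormedAddCommGroup E] [NormedSpace ℝ E] (T : ℝ) (m : ℕ) (f : ℝ → E) : Prop :=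
  ∃ r : ℕ → ℝ → E, (∀ j, SP T (r j)) ∧ ∀ t, f t = ∑ j ∈ Finset.range (m + 1), t ^ j • r j t

section QPbasic
variable {E : Type*} [NormedAddCommGroup E] [NormedSpace ℝ E] {T : ℝ}

lemma SP.add {f g : ℝ → E} (hf : SP T f) (hg : SP T g) : SP T (fun t => f t + g t) :=
  ⟨hf.1.add hg.1, fun t => by simp only [hf.2 t, hg.2 t]⟩

lemma SP.smul {f : ℝ → E} {c : ℝ → ℝ} (hc : SP T c) (hf : SP T f) : SP T (fun t => c t • f t) :=
  ⟨hc.1.smul hf.1, fun t => by simp only [hf.2 t, hc.2 t]⟩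

lemma SP.const (c : E) : SP T (fun _ => c) := ⟨contDiff_const, fun _ => rfl⟩

lemma QP.of_SP {f : ℝ → E} (hf : SP T f) : QP T 0 f :=
  ⟨fun _ => f, fun _ => hf, fun t => by simp⟩

lemma QP.zero_SP {f : ℝ → E} (hf : QP T 0 f) : SP T f := by
  obtain ⟨r, hr, h⟩ := hf
  have : f = r 0 := by funext t; simpa using h t
  rw [this]; exact hr 0

lemma QP.succ {m : ℕ} {f g : ℝ → E} (hf : SP T f) (hg : QP T m g) :
    QP T (m + 1) (fun t => t ^ (m + 1) • f t + g t) := by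
  obtain ⟨r, hr, h⟩ := hg
  refine ⟨Function.update r (m + 1) f, fun j => ?_, fun t => ?_⟩
  · by_cases hj : j = m + 1
    · subst hj; simpa using hf
    · simpa [Function.update_of_ne hj] using hr j
  · show t ^ (m + 1) • f t + g t = _
    rw [Finset.sum_range_succ, add_comm (t ^ (m + 1) • f t), h t]
    congr 1
    · apply Finset.sum_congr rfl
      intro j hj
      rw [Function.update_of_ne]
      have := Finset.mem_range.1 hj
      omega
    · simp

lemma QP.succ_elim {m : ℕ} {f : ℝ → E} (hf : QP T (m + 1) f) :
    ∃ r g, SP T r ∧ QP T m g ∧ f = fun t => t ^ (m + 1) • r t + g t := by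
  obtain ⟨r, hr, h⟩ := hf
  refine ⟨r (m + 1), fun t => ∑ j ∈ Finset.range (m + 1), t ^ j • r j t, hr _, ⟨r, hr, fun t => rfl⟩, ?_⟩
  funext t
  rw [h t, Finset.sum_range_succ, add_comm]

lemma QP.mono_succ {m : ℕ} {f : ℝ → E} (hf : QP T m f) : QP T (m + 1) f := by
  simpa using QP.succ (SP.const (0 : E)) hf

lemma QP.add {m : ℕ} {f g : ℝ → E} (hf : QP T m f) (hg : QP T m g) : QP T m (fun t => f t + g t) := by
  obtain ⟨r, hr, h⟩ := hf
  obtain ⟨r', hr', h'⟩ := hg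
  refine ⟨fun j t => r j t + r' j t, fun j => (hr j).add (hr' j), fun t => ?_⟩
  simp only [h t, h' t, smul_add, Finset.sum_add_distrib]

lemma QP.smul {m : ℕ} {f : ℝ → E} {c : ℝ → ℝ} (hc : SP T c) (hf : QP T m f) :
    QP T m (fun t => c t • f t) := by
  obtain ⟨r, hr, h⟩ := hf
  refine ⟨fun j t => c t • r j t, fun j => hc.smul (hr j), fun t => ?_⟩
  simp only [h t, Finset.smul_sum]
  refine Finset.sum_congr rfl fun j _ => smul_comm _ _ _

lemma QP.clm {F : Type*} [NormedAddCommGroup F] [NormedSpace ℝ F] (l : E →L[ℝ] F)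
    {m : ℕ} {f : ℝ → E} (hf : QP T m f) : QP T m (fun t => l (f t)) := by
  obtain ⟨r, hr, h⟩ := hf
  refine ⟨fun j t => l (r j t), fun j => ⟨l.contDiff.comp (hr j).1, fun t => ?_⟩, fun t => ?_⟩
  · simp only [(hr j).2 t]
  · simp only [h t, map_sum, map_smul]

lemma QP.pow {m : ℕ} {f : ℝ → E} (hf : SP T f) : QP T m (fun t => t ^ m • f t) := by
  cases m with
  | zero => simpa using QP.of_SP hf
  | succ k =>
    have h0 : QP T k (fun _ => (0 : E)) := ⟨fun _ _ => 0, fun _ => SP.const 0, fun t => by simp⟩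
    simpa using QP.succ hf h0
end QPbasic

lemma smooth_of_deriv {E : Type*} [NormedAddCommGroup E] [NormedSpace ℝ E] {F f : ℝ → E}
    (h : ∀ t, HasDerivAt F (f t) t) (hf : ContDiff ℝ (⊤ : ℕ∞) f) : ContDiff ℝ (⊤ : ℕ∞) F := by
  rw [contDiff_infty_iff_deriv]
  refine ⟨fun t => (h t).differentiableAt, ?_⟩
  have : deriv F = f := funext fun t => (h t).deriv
  rwa [this]

lemma solve0 {T : ℝ} (hT : 0 < T) {μ : ℂ} (hμ : μ.re ≠ 0) {g : ℝ → ℂ} (hg : SP T g) :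
    ∃ s, SP T s ∧ ∀ t, HasDerivAt s (μ * s t + g t) t := by
  have hcexp : ∀ ν : ℂ, ContDiff ℝ (⊤ : ℕ∞) (fun t : ℝ => Complex.exp (ν * t)) := fun ν =>
    (contDiff_const.mul Complex.ofRealCLM.contDiff).cexp
  have hdexp : ∀ (ν : ℂ) (t : ℝ), HasDerivAt (fun t : ℝ => Complex.exp (ν * t))
      (Complex.exp (ν * t) * ν) t := fun ν t => by
    have h1 : HasDerivAt (fun t : ℝ => ν * (t : ℂ)) ν t := by
      simpa using (Complex.ofRealCLM.hasDerivAt (x := t)).const_mul ν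
    exact h1.cexp
  let k : ℝ → ℂ := fun t => Complex.exp (-μ * t) * g t
  have hk : ContDiff ℝ (⊤ : ℕ∞) k := (hcexp (-μ)).mul hg.1
  let J : ℝ → ℂ := fun t => ∫ x in (0 : ℝ)..t, k x
  have hJ : ∀ t, HasDerivAt J (k t) t := fun t =>
    intervalIntegral.integral_hasDerivAt_right (hk.continuous.intervalIntegrable _ _)
      (hk.continuous.stronglyMeasurableAtFilter _ _) hk.continuous.continuousAt
  have hJs := smooth_of_deriv hJ hk
  have hkT : ∀ t, k (t + T) = Complex.exp (-μ * T) * k t := fun t => by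
    simp only [k, hg.2 t]
    push_cast
    rw [mul_add, Complex.exp_add]; ring
  have hJT : ∀ t, J (t + T) = J T + Complex.exp (-μ * T) * J t := by
    have hd : ∀ t, HasDerivAt (fun t => J (t + T) - Complex.exp (-μ * T) * J t) 0 t := fun t => by
      have := ((hJ (t + T)).comp_add_const t T).sub ((hJ t).const_mul (Complex.exp (-μ * T)))
      rw [hkT, sub_self] at this
      exact this
    intro t
    have := is_const_of_deriv_eq_zero (fun t => (hd t).differentiableAt) (fun t => (hd t).deriv) t 0
    have hJ0 : J 0 = 0 := by simp [J]
    simp only [zero_add, hJ0, mul_zero, sub_zero] at this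
    linear_combination this
  have hne : (1 : ℂ) - Complex.exp (-μ * T) ≠ 0 := by
    intro h0
    have : ‖Complex.exp (-μ * T)‖ = 1 := by
      rw [← sub_eq_zero.1 h0]; simp
    rw [Complex.norm_exp, Real.exp_eq_one_iff] at this
    simp at this
    rcases this with h | h
    · exact hμ h
    · exact hT.ne' h
  set e := Complex.exp (-μ * T) with he
  have hee : Complex.exp (μ * T) * e = 1 := by
    rw [he, ← Complex.exp_add]; simp
  -- C + J T + e J t = e (C + J t)
  let C : ℂ := - J T / (1 - e)
  have hC : C + J T = e * C := by
    simp only [C]; field_simp; ring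
  refine ⟨fun t => Complex.exp (μ * t) * (C + J t), ⟨(hcexp μ).mul (contDiff_const.add hJs), ?_⟩, ?_⟩
  · intro t
    simp only [hJT]
    rw [Complex.ofReal_add, mul_add μ, Complex.exp_add]
    linear_combination (Complex.exp (μ * t) * Complex.exp (μ * T)) * hC + Complex.exp (μ * t) * (C + J t) * hee
  · intro t
    have := (hdexp μ t).mul ((hJ t).const_add C)
    refine this.congr_deriv ?_
    have h2 : Complex.exp (μ * t) * k t = g t := by
      simp only [k]; rw [← mul_assoc, ← Complex.exp_add]; simp
    rw [h2]; ring

lemma hasDeriv_pow_smul {E : Type*} [NormedAddCommGroup E] [NormedSpace ℝ E] {s : ℝ → E} {s' : E}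
    {t : ℝ} (m : ℕ) (h : HasDerivAt s s' t) :
    HasDerivAt (fun t => t ^ (m + 1) • s t) (t ^ (m + 1) • s' + (((m : ℝ) + 1) * t ^ m) • s t) t := by
  have := (hasDerivAt_pow (m + 1) t).smul h
  refine HasDerivAt.congr_deriv this ?_
  simp

lemma solveC {T : ℝ} (hT : 0 < T) {μ : ℂ} (hμ : μ.re ≠ 0) (m : ℕ) : ∀ {g : ℝ → ℂ}, QP T m g →
    ∃ s, QP T m s ∧ ∀ t, HasDerivAt s (μ * s t + g t) t := by
  induction m with
  | zero =>
    intro g hg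
    obtain ⟨s, hs, h⟩ := solve0 hT hμ hg.zero_SP
    exact ⟨s, QP.of_SP hs, h⟩
  | succ m ih =>
    intro g hg
    obtain ⟨r, g0, hr, hg0, rfl⟩ := hg.succ_elim
    obtain ⟨s, hs, h⟩ := solve0 hT hμ hr
    obtain ⟨v, hv, hv'⟩ := ih (hg0.add ((QP.pow (m := m) hs).smul (SP.const (-((m : ℝ) + 1)))))
    refine ⟨_, QP.succ hs hv, fun t => ?_⟩
    refine HasDerivAt.congr_deriv ((hasDeriv_pow_smul m (h t)).add (hv' t)) ?_
    simp only [Complex.real_smul]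
    push_cast
    ring

lemma solveR {T : ℝ} (hT : 0 < T) {μ : ℝ} (hμ : μ ≠ 0) (m : ℕ) {g : ℝ → ℝ} (hg : QP T m g) :
    ∃ s, QP T m s ∧ ∀ t, HasDerivAt s (μ * s t + g t) t := by
  obtain ⟨s, hs, h⟩ := solveC hT (μ := (μ : ℂ)) (by simpa using hμ) m (hg.clm Complex.ofRealCLM)
  refine ⟨_, hs.clm Complex.reCLM, fun t => ?_⟩
  have := Complex.reCLM.hasFDerivAt.comp_hasDerivAt t (h t)
  simpa [Function.comp_def] using this

lemma mean0 {T : ℝ} (hT : 0 < T) {g : ℝ → ℝ} (hg : SP T g) :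
    ∃ κ s, SP T s ∧ ∀ t, HasDerivAt s (g t - κ) t := by
  let J : ℝ → ℝ := fun t => ∫ x in (0 : ℝ)..t, g x
  have hJ : ∀ t, HasDerivAt J (g t) t := fun t =>
    intervalIntegral.integral_hasDerivAt_right (hg.1.continuous.intervalIntegrable _ _)
      (hg.1.continuous.stronglyMeasurableAtFilter _ _) hg.1.continuous.continuousAt
  have hJT : ∀ t, J (t + T) = J T + J t := by
    have hd : ∀ t, HasDerivAt (fun t => J (t + T) - J t) 0 t := fun t => by
      have := ((hJ (t + T)).comp_add_const t T).sub (hJ t)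
      rw [hg.2, sub_self] at this
      exact this
    intro t
    have := is_const_of_deriv_eq_zero (fun t => (hd t).differentiableAt) (fun t => (hd t).deriv) t 0
    have hJ0 : J 0 = 0 := by simp [J]
    simp only [zero_add, hJ0, sub_zero] at this
    linarith
  have hd : ∀ t, HasDerivAt (fun t => J t - (J T / T) * t) (g t - J T / T) t := fun t => by
    refine HasDerivAt.congr_deriv ((hJ t).sub ((hasDerivAt_id t).const_mul (J T / T))) ?_
    simp
  refine ⟨J T / T, fun t => J t - (J T / T) * t,
    ⟨smooth_of_deriv hd (hg.1.sub contDiff_const), fun t => ?_⟩, hd⟩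
  simp only [hJT]
  field_simp
  ring

lemma solveZ {T : ℝ} (hT : 0 < T) (m : ℕ) : ∀ {g : ℝ → ℝ}, QP T m g →
    ∃ s, QP T (m + 1) s ∧ ∀ t, HasDerivAt s (g t) t := by
  induction m with
  | zero =>
    intro g hg
    obtain ⟨κ, s, hs, h⟩ := mean0 hT hg.zero_SP
    refine ⟨_, QP.succ (SP.const κ) (QP.of_SP hs), fun t => ?_⟩
    refine HasDerivAt.congr_deriv ((hasDeriv_pow_smul 0 (hasDerivAt_const t κ)).add (h t)) ?_
    simp
  | succ m ih =>
    intro g hg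
    obtain ⟨r, g0, hr, hg0, rfl⟩ := hg.succ_elim
    obtain ⟨κ, s, hs, h⟩ := mean0 hT hr
    obtain ⟨v, hv, hv'⟩ := ih (hg0.add ((QP.pow (m := m) hs).smul (SP.const (-((m : ℝ) + 1)))))
    refine ⟨_, QP.succ (SP.const (κ / ((m : ℝ) + 2))) (QP.add (QP.pow (m := m + 1) hs) hv), fun t => ?_⟩
    refine HasDerivAt.congr_deriv ((hasDeriv_pow_smul (m + 1) (hasDerivAt_const t (κ / ((m : ℝ) + 2)))).add
      ((hasDeriv_pow_smul m (h t)).add (hv' t))) ?_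
    have : (m : ℝ) + 2 ≠ 0 := by positivity
    simp only [smul_eq_mul]
    push_cast
    field_simp
    ring

/-- uniqueness for `u'' = V u` -/
lemma ode_unique {u w V : ℝ → ℝ} {K : ℝ} (hK : ∀ t, |V t| ≤ K)
    (hu : ∀ t, HasDerivAt u (w t) t) (hw : ∀ t, HasDerivAt w (V t * u t) t)
    {t₀ : ℝ} (h0 : u t₀ = 0) (h1 : w t₀ = 0) : ∀ t, u t = 0 := by
  have hE : ∀ t, HasDerivAt (fun t => u t ^ 2 + w t ^ 2) (2 * (1 + V t) * (u t * w t)) t := fun t => by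
    refine HasDerivAt.congr_deriv (((hu t).pow 2).add ((hw t).pow 2)) ?_
    push_cast; ring
  have hb : ∀ t, |2 * (1 + V t) * (u t * w t)| ≤ (1 + K) * (u t ^ 2 + w t ^ 2) := fun t => by
    have h3 : |1 + V t| ≤ 1 + K := (abs_add_le _ _).trans (by simpa using hK t)
    have h4 : 2 * |u t * w t| ≤ u t ^ 2 + w t ^ 2 := by
      rw [abs_mul, ← sq_abs (u t), ← sq_abs (w t)]
      nlinarith [sq_nonneg (|u t| - |w t|)]
    have : |2 * (1 + V t) * (u t * w t)| = |1 + V t| * (2 * |u t * w t|) := by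
      rw [abs_mul, abs_mul]; simp; ring
    rw [this]
    exact mul_le_mul h3 h4 (by positivity) ((abs_nonneg _).trans h3)
  have hex : ∀ c t : ℝ, HasDerivAt (fun t => Real.exp (c * t)) (Real.exp (c * t) * c) t := fun c t => by
    simpa using ((hasDerivAt_id t).const_mul c).exp
  have hm : Monotone (fun t => Real.exp ((1 + K) * t) * (u t ^ 2 + w t ^ 2)) := by
    refine monotone_of_hasDerivAt_nonneg (fun t => (hex _ t).mul (hE t)) fun t => ?_
    have := (abs_le.1 (hb t)).1
    have he := Real.exp_pos ((1 + K) * t)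
    simp only [Pi.zero_apply]
    nlinarith
  have ha : Antitone (fun t => Real.exp (-(1 + K) * t) * (u t ^ 2 + w t ^ 2)) := by
    refine antitone_of_hasDerivAt_nonpos (fun t => (hex _ t).mul (hE t)) fun t => ?_
    have := (abs_le.1 (hb t)).2
    have he := Real.exp_pos (-(1 + K) * t)
    simp only [Pi.zero_apply]
    nlinarith
  intro t
  have key : u t ^ 2 + w t ^ 2 ≤ 0 := by
    rcases le_total t t₀ with h | h
    · have := hm h
      simp only [h0, h1] at this
      have he := Real.exp_pos ((1 + K) * t)
      by_contra! hc
      have := mul_pos he hc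
      norm_num at *
      linarith
    · have := ha h
      simp only [h0, h1] at this
      have he := Real.exp_pos (-(1 + K) * t)
      by_contra! hc
      have := mul_pos he hc
      norm_num at *
      linarith
  have : u t ^ 2 = 0 := by nlinarith [sq_nonneg (u t), sq_nonneg (w t)]
  exact pow_eq_zero_iff (two_ne_zero) |>.1 this

lemma periodic_bdd {V : ℝ → ℝ} {T : ℝ} (hT : 0 < T) (hV : Continuous V) (hp : Function.Periodic V T) :
    ∃ K, ∀ t, |V t| ≤ K := by
  obtain ⟨K, hK⟩ := (isCompact_Icc (a := (0 : ℝ)) (b := T)).exists_bound_of_continuousOn hV.continuousOn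
  refine ⟨K, fun t => ?_⟩
  obtain ⟨y, hy, hyt⟩ := hp.exists_mem_Ico₀ hT t
  rw [hyt]
  exact hK y ⟨hy.1, hy.2.le⟩

/-- `e^{-γ t} ψ` with `ψ ∈ QP T M` solves `-φ'' + V φ = t^m e^{-γ t} h`. -/
def Good (T : ℝ) (V : ℝ → ℝ) (γ : ℝ) (m : ℕ) (h : ℝ → ℝ) (M : ℕ) (φ : ℝ → ℝ) : Prop :=
  (∃ ψ, QP T M ψ ∧ ∀ t, φ t = Real.exp (-γ * t) * ψ t) ∧ ∃ φ₁ : ℝ → ℝ,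
    (∀ t, HasDerivAt φ (φ₁ t) t) ∧
    ∀ t, HasDerivAt φ₁ (V t * φ t - t ^ m * Real.exp (-γ * t) * h t) t

lemma hexp (c t : ℝ) : HasDerivAt (fun t => Real.exp (c * t)) (Real.exp (c * t) * c) t := by
  simpa using ((hasDerivAt_id t).const_mul c).exp

/-- variation of constants -/
lemma voc {u₁ w₁ u₂ w₂ A B V f : ℝ → ℝ} {W : ℝ} (hW : W ≠ 0)
    (hu₁ : ∀ t, HasDerivAt u₁ (w₁ t) t) (hw₁ : ∀ t, HasDerivAt w₁ (V t * u₁ t) t)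
    (hu₂ : ∀ t, HasDerivAt u₂ (w₂ t) t) (hw₂ : ∀ t, HasDerivAt w₂ (V t * u₂ t) t)
    (hWr : ∀ t, u₁ t * w₂ t - w₁ t * u₂ t = W)
    (hA : ∀ t, HasDerivAt A (u₂ t * f t) t) (hB : ∀ t, HasDerivAt B (u₁ t * f t) t) :
    (∀ t, HasDerivAt (fun t => W⁻¹ * (u₁ t * A t - u₂ t * B t)) (W⁻¹ * (w₁ t * A t - w₂ t * B t)) t) ∧
    (∀ t, HasDerivAt (fun t => W⁻¹ * (w₁ t * A t - w₂ t * B t))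
      (V t * (W⁻¹ * (u₁ t * A t - u₂ t * B t)) - f t) t) := by
  constructor
  · intro t
    refine HasDerivAt.congr_deriv
      ((((hu₁ t).mul (hA t)).sub ((hu₂ t).mul (hB t))).const_mul W⁻¹) ?_
    ring
  · intro t
    refine HasDerivAt.congr_deriv
      ((((hw₁ t).mul (hA t)).sub ((hw₂ t).mul (hB t))).const_mul W⁻¹) ?_
    have : W⁻¹ * (u₁ t * w₂ t - w₁ t * u₂ t) = 1 := by rw [hWr]; field_simp
    linear_combination (-f t) * this

lemma case_pos {T : ℝ} (hT : 0 < T) {V : ℝ → ℝ} (hV : Continuous V) (hVp : Function.Periodic V T)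
    {s γ : ℝ} (hs : 0 < s) (hγ : 0 < γ) {q₁ q₂ h : ℝ → ℝ} (m : ℕ) (hh : SP T h)
    (hq₁ : SP T q₁) (hq₂ : SP T q₂) {u₁ w₁ u₂ w₂ : ℝ → ℝ}
    (e₁ : ∀ t, u₁ t = Real.exp (-s * t) * q₁ t) (e₂ : ∀ t, u₂ t = Real.exp (s * t) * q₂ t)
    (hu₁ : ∀ t, HasDerivAt u₁ (w₁ t) t) (hw₁ : ∀ t, HasDerivAt w₁ (V t * u₁ t) t)
    (hu₂ : ∀ t, HasDerivAt u₂ (w₂ t) t) (hw₂ : ∀ t, HasDerivAt w₂ (V t * u₂ t) t)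
    (hli : LinearIndependent ℝ ![u₁, u₂]) :
    ∃ φ, (γ ≠ s → Good T V γ m h m φ) ∧ (γ = s → Good T V γ m h (m + 1) φ) := by
  obtain ⟨K, hK⟩ := periodic_bdd hT hV hVp
  have hWd : ∀ t, HasDerivAt (fun t => u₁ t * w₂ t - w₁ t * u₂ t) 0 t := fun t => by
    refine HasDerivAt.congr_deriv (((hu₁ t).mul (hw₂ t)).sub ((hw₁ t).mul (hu₂ t))) ?_
    ring
  have hWr : ∀ t, u₁ t * w₂ t - w₁ t * u₂ t = u₁ 0 * w₂ 0 - w₁ 0 * u₂ 0 := fun t =>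
    is_const_of_deriv_eq_zero (fun t => (hWd t).differentiableAt) (fun t => (hWd t).deriv) t 0
  have hlin : ∀ c d : ℝ, c * u₁ 0 + d * u₂ 0 = 0 → c * w₁ 0 + d * w₂ 0 = 0 → c = 0 ∧ d = 0 := by
    intro c d h0 h1
    have hz := ode_unique (u := fun t => c * u₁ t + d * u₂ t) (w := fun t => c * w₁ t + d * w₂ t)
      (V := V) hK (fun t => ((hu₁ t).const_mul c).add ((hu₂ t).const_mul d))
      (fun t => HasDerivAt.congr_deriv (((hw₁ t).const_mul c).add ((hw₂ t).const_mul d)) (by ring))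
      (t₀ := 0) h0 h1
    refine LinearIndependent.pair_iff.1 hli c d ?_
    funext t
    simpa using hz t
  have hW : u₁ 0 * w₂ 0 - w₁ 0 * u₂ 0 ≠ 0 := by
    intro h0
    have h1 := hlin (w₂ 0) (-w₁ 0) (by linarith) (by ring)
    have h2 := hlin (u₂ 0) (-u₁ 0) (by ring) (by linarith)
    have h3 := hlin 1 0 (by linarith [h2.2]) (by linarith [h1.2])
    exact one_ne_zero h3.1
  set W := u₁ 0 * w₂ 0 - w₁ 0 * u₂ 0
  have hp₁ : QP T m (fun t => t ^ m • (q₁ t • h t)) := QP.pow (hq₁.smul hh)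
  have hp₂ : QP T m (fun t => t ^ m • (q₂ t • h t)) := QP.pow (hq₂.smul hh)
  obtain ⟨v, hv, hv'⟩ := solveR hT (μ := s + γ) (by positivity) m hp₁
  have hB : ∀ t, HasDerivAt (fun t => Real.exp (-(s + γ) * t) * v t)
      (u₁ t * (t ^ m * Real.exp (-γ * t) * h t)) t := fun t => by
    refine HasDerivAt.congr_deriv ((hexp _ t).mul (hv' t)) ?_
    have : Real.exp (-(s + γ) * t) = Real.exp (-s * t) * Real.exp (-γ * t) := by
      rw [← Real.exp_add]; ring_nf
    rw [e₁, this]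
    simp only [smul_eq_mul]
    ring
  have hsig : ∃ v₂, (∀ t, HasDerivAt v₂ ((γ - s) * v₂ t + t ^ m • (q₂ t • h t)) t) ∧
      (γ ≠ s → QP T m v₂) ∧ (γ = s → QP T (m + 1) v₂) := by
    by_cases hgs : γ = s
    · obtain ⟨v₂, hv₂, h2⟩ := solveZ hT m hp₂
      exact ⟨v₂, fun t => (h2 t).congr_deriv (by rw [hgs]; ring), fun h => absurd hgs h, fun _ => hv₂⟩
    · obtain ⟨v₂, hv₂, h2⟩ := solveR hT (sub_ne_zero.2 hgs) m hp₂
      exact ⟨v₂, h2, fun _ => hv₂, fun h => absurd h hgs⟩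
  obtain ⟨v₂, hv₂', hne, heq⟩ := hsig
  have hA : ∀ t, HasDerivAt (fun t => Real.exp (-(γ - s) * t) * v₂ t)
      (u₂ t * (t ^ m * Real.exp (-γ * t) * h t)) t := fun t => by
    refine HasDerivAt.congr_deriv ((hexp _ t).mul (hv₂' t)) ?_
    have : Real.exp (-(γ - s) * t) = Real.exp (s * t) * Real.exp (-γ * t) := by
      rw [← Real.exp_add]; ring_nf
    rw [e₂, this]
    simp only [smul_eq_mul]
    ring
  obtain ⟨d1, d2⟩ := voc hW hu₁ hw₁ hu₂ hw₂ hWr hA hB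
  have key : ∀ M, QP T M v → QP T M v₂ → Good T V γ m h M
      (fun t => W⁻¹ * (u₁ t * (Real.exp (-(γ - s) * t) * v₂ t) - u₂ t * (Real.exp (-(s + γ) * t) * v t))) := by
    intro M hM hM₂
    refine ⟨⟨_, ((hM₂.smul hq₁).add ((hM.smul hq₂).smul (SP.const (-1)))).smul (SP.const W⁻¹),
      fun t => ?_⟩, _, d1, d2⟩
    have x1 : Real.exp (-s * t) * Real.exp (-(γ - s) * t) = Real.exp (-γ * t) := by
      rw [← Real.exp_add]; ring_nf
    have x2 : Real.exp (s * t) * Real.exp (-(s + γ) * t) = Real.exp (-γ * t) := by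
      rw [← Real.exp_add]; ring_nf
    simp only [smul_eq_mul, e₁, e₂]
    linear_combination (W⁻¹ * q₁ t * v₂ t) * x1 - (W⁻¹ * q₂ t * v t) * x2
  exact ⟨_, fun h => key m hv (hne h), fun h => key (m + 1) hv.mono_succ (heq h)⟩

/-- the case of a periodic kernel element -/
lemma case_zero {T : ℝ} (hT : 0 < T) {V : ℝ → ℝ} (hV : SP T V)
    {γ : ℝ} (hγ : 0 < γ) {h : ℝ → ℝ} (m : ℕ) (hh : SP T h)
    {u w : ℝ → ℝ} (hus : SP T u) (hws : SP T w)
    (hu : ∀ t, HasDerivAt u (w t) t) (hw : ∀ t, HasDerivAt w (V t * u t) t)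
    (hnz : ∃ t, u t ≠ 0) :
    ∃ φ, Good T V γ m h m φ := by
  obtain ⟨K, hK⟩ := periodic_bdd hT hV.1.continuous hV.2
  have hR : ∀ t, u t ^ 2 + w t ^ 2 ≠ 0 := by
    intro t h0
    obtain ⟨t₁, h1⟩ := hnz
    refine h1 (ode_unique hK hu hw (t₀ := t) ?_ ?_ t₁)
    · nlinarith [sq_nonneg (u t), sq_nonneg (w t)]
    · nlinarith [sq_nonneg (u t), sq_nonneg (w t)]
  have hRs : SP T (fun t => u t ^ 2 + w t ^ 2) :=
    ⟨(hus.1.pow 2).add (hws.1.pow 2), fun t => by simp only [hus.2 t, hws.2 t]⟩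
  have hg : SP T (fun t => (1 + V t) * (u t ^ 2 - w t ^ 2) / (u t ^ 2 + w t ^ 2) ^ 2) :=
    ⟨((contDiff_const.add hV.1).mul ((hus.1.pow 2).sub (hws.1.pow 2))).div (hRs.1.pow 2)
      (fun t => pow_ne_zero _ (hR t)), fun t => by simp only [hus.2 t, hws.2 t, hV.2 t]⟩
  obtain ⟨κ, s, hs, hs'⟩ := mean0 hT hg
  have hA' : ∀ t, HasDerivAt (fun t => κ * t + s t)
      ((1 + V t) * (u t ^ 2 - w t ^ 2) / (u t ^ 2 + w t ^ 2) ^ 2) t := fun t => by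
    refine HasDerivAt.congr_deriv (((hasDerivAt_id t).const_mul κ).add (hs' t)) ?_
    ring
  have hRd : ∀ t, HasDerivAt (fun t => u t ^ 2 + w t ^ 2) (2 * (1 + V t) * (u t * w t)) t := fun t => by
    refine HasDerivAt.congr_deriv (((hu t).pow 2).add ((hw t).pow 2)) ?_
    push_cast; ring
  have hu₂ : ∀ t, HasDerivAt (fun t => u t * (κ * t + s t) - w t / (u t ^ 2 + w t ^ 2))
      (w t * (κ * t + s t) + u t / (u t ^ 2 + w t ^ 2)) t := fun t => by
    refine HasDerivAt.congr_deriv (((hu t).mul (hA' t)).sub ((hw t).div (hRd t) (hR t))) ?_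
    have := hR t
    field_simp
    ring
  have hw₂ : ∀ t, HasDerivAt (fun t => w t * (κ * t + s t) + u t / (u t ^ 2 + w t ^ 2))
      (V t * (u t * (κ * t + s t) - w t / (u t ^ 2 + w t ^ 2))) t := fun t => by
    refine HasDerivAt.congr_deriv (((hw t).mul (hA' t)).add ((hu t).div (hRd t) (hR t))) ?_
    have := hR t
    field_simp
    ring
  have hWr : ∀ t, u t * (w t * (κ * t + s t) + u t / (u t ^ 2 + w t ^ 2))
      - w t * (u t * (κ * t + s t) - w t / (u t ^ 2 + w t ^ 2)) = 1 := fun t => by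
    have := hR t
    field_simp
    ring
  have hq₂ : SP T (fun t => u t * s t - w t / (u t ^ 2 + w t ^ 2)) :=
    ⟨(hus.1.mul hs.1).sub (hws.1.div hRs.1 hR), fun t => by simp only [hus.2 t, hws.2 t, hs.2 t]⟩
  set q₂ : ℝ → ℝ := fun t => u t * s t - w t / (u t ^ 2 + w t ^ 2) with hq₂d
  obtain ⟨v, hv, hv'⟩ := solveR hT hγ.ne' m (QP.pow (m := m) (hus.smul hh))
  obtain ⟨x, hx, hx'⟩ := solveR hT hγ.ne' m hv
  obtain ⟨z, hz, hz'⟩ := solveR hT hγ.ne' m (QP.pow (m := m) (hq₂.smul hh))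
  have hB : ∀ t, HasDerivAt (fun t => Real.exp (-γ * t) * v t)
      (u t * (t ^ m * Real.exp (-γ * t) * h t)) t := fun t => by
    refine HasDerivAt.congr_deriv ((hexp _ t).mul (hv' t)) ?_
    simp only [smul_eq_mul]
    ring
  have hA : ∀ t, HasDerivAt (fun t => Real.exp (-γ * t) * (z t + κ * (t * v t - x t)))
      ((u t * (κ * t + s t) - w t / (u t ^ 2 + w t ^ 2)) * (t ^ m * Real.exp (-γ * t) * h t)) t := fun t => by
    refine HasDerivAt.congr_deriv ((hexp _ t).mul
      ((hz' t).add ((((hasDerivAt_id t).mul (hv' t)).sub (hx' t)).const_mul κ))) ?_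
    simp only [smul_eq_mul, hq₂d, id]
    ring
  obtain ⟨d1, d2⟩ := voc one_ne_zero hu hw hu₂ hw₂ hWr hA hB
  refine ⟨_, ⟨_, ((hz.smul hus).add ((hx.smul hus).smul (SP.const (-κ)))).add
    ((hv.smul hq₂).smul (SP.const (-1))), fun t => ?_⟩, _, d1, d2⟩
  simp only [smul_eq_mul, hq₂d, inv_one]
  ring

/-- the case of constant nonpositive potential -/
lemma case_const {T : ℝ} (hT : 0 < T) {V : ℝ → ℝ} {ω : ℝ} (hV : ∀ t, V t = -ω ^ 2)
    {γ : ℝ} (hγ : 0 < γ) {h : ℝ → ℝ} (m : ℕ) (hh : SP T h) :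
    ∃ φ, Good T V γ m h m φ := by
  obtain ⟨y, hy, hy'⟩ := solveC hT (μ := (γ : ℂ) + ω * Complex.I) (by simpa using hγ.ne') m
    ((QP.pow (m := m) hh).clm Complex.ofRealCLM)
  obtain ⟨x, hx, hx'⟩ := solveC hT (μ := (γ : ℂ) - ω * Complex.I) (by simpa using hγ.ne') m hy
  have hre : ∀ {F : ℝ → ℂ} {F' : ℂ} {t : ℝ}, HasDerivAt F F' t →
      HasDerivAt (fun t => (F t).re) F'.re t := fun {F F' t} hF => by
    simpa [Function.comp_def] using Complex.reCLM.hasFDerivAt.comp_hasDerivAt t hF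
  have h1 := fun t => hre (hx' t)
  have h2 := fun t => hre (((hx' t).const_mul ((γ : ℂ) - ω * Complex.I)).add (hy' t))
  refine ⟨fun t => Real.exp (-γ * t) * (-(x t).re), ⟨_, ?_, fun t => rfl⟩, _,
    fun t => (hexp _ t).mul (h1 t).neg, fun t => ?_⟩
  · simpa using (hx.clm Complex.reCLM).smul (SP.const (-1))
  · refine HasDerivAt.congr_deriv
      (((hexp (-γ) t).mul_const (-γ) |>.mul (h1 t).neg).add ((hexp (-γ) t).mul (h2 t).neg)) ?_
    rw [hV]
    have hpw : ((t : ℂ) ^ m).re = t ^ m := by rw [← Complex.ofReal_pow, Complex.ofReal_re]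
    simp [hpw]
    ring

lemma zeta_smooth {ζ : ℝ → ℝ} {c p : ℝ} (hc : ContDiff ℝ 2 ζ) (hpos : ∀ t, 0 < ζ t)
    (heq : ∀ t, deriv (deriv ζ) t = c * ζ t - ζ t ^ (p - 1)) : ContDiff ℝ (⊤ : ℕ∞) ζ := by
  rw [contDiff_infty]
  have d1 : Differentiable ℝ ζ := hc.differentiable (by norm_num)
  have d2 : Differentiable ℝ (deriv ζ) :=
    ((contDiff_succ_iff_deriv (n := 1)).1 hc).2.2.differentiable (by norm_num)
  intro k
  induction k with
  | zero => exact hc.of_le (by norm_num)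
  | succ k ih =>
    have e : deriv (deriv ζ) = fun t => c * ζ t - ζ t ^ (p - 1) := funext heq
    have h2 : ContDiff ℝ k (deriv (deriv ζ)) := by
      rw [e]
      exact (contDiff_const.mul ih).sub (ih.rpow_const_of_ne fun t => (hpos t).ne')
    have h3 : ContDiff ℝ (k + 1) (deriv ζ) := contDiff_succ_iff_deriv.2 ⟨d2, by simp, h2⟩
    push_cast
    exact contDiff_succ_iff_deriv.2 ⟨d1, by simp, h3.of_le (by norm_cast; omega)⟩

lemma sphEval_zero (n : ℕ) (hn : 3 ≤ n) : sphEval n 0 = 0 := by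
  have : sphDeg n 0 = 0 := by
    unfold sphDeg
    apply Nat.sInf_eq_zero.2
    left
    simp [cumHarm]
  simp [sphEval, this]

lemma Good.final {T : ℝ} {V : ℝ → ℝ} {γ : ℝ} {m M : ℕ} {h φ : ℝ → ℝ} (hg : Good T V γ m h M φ) :
    (∀ t, -dtt φ t + V t * φ t = t ^ m * Real.exp (-γ * t) * h t) ∧ ∃ r : ℕ → ℝ → ℝ,
        (∀ j, j ≤ M → ContDiff ℝ (⊤ : ℕ∞) (r j) ∧ Function.Periodic (r j) T) ∧
        ∀ t, φ t = Real.exp (-γ * t) * ∑ j ∈ Finset.range (M + 1), t ^ j * r j t := by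
  obtain ⟨⟨ψ, ⟨r, hr, hψ⟩, hφ⟩, φ₁, h1, h2⟩ := hg
  refine ⟨fun t => ?_, r, fun j _ => hr j, fun t => ?_⟩
  · have : deriv φ = φ₁ := funext fun t => (h1 t).deriv
    rw [dtt, this, (h2 t).deriv]
    ring
  · rw [hφ, hψ]; simp

lemma Good.mono {T : ℝ} {V : ℝ → ℝ} {γ : ℝ} {m M : ℕ} {h φ : ℝ → ℝ} (hg : Good T V γ m h M φ) :
    Good T V γ m h (M + 1) φ := by
  obtain ⟨⟨ψ, h1, h2⟩, h3⟩ := hg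
  exact ⟨⟨ψ, h1.mono_succ, h2⟩, h3⟩

lemma derivs_of_C2 {u : ℝ → ℝ} (hu : ContDiff ℝ 2 u) :
    (∀ t, HasDerivAt u (deriv u t) t) ∧ ∀ t, HasDerivAt (deriv u) (dtt u t) t := by
  have d1 : Differentiable ℝ u := hu.differentiable (by norm_num)
  have d2 : Differentiable ℝ (deriv u) :=
    ((contDiff_succ_iff_deriv (n := 1)).1 hu).2.2.differentiable (by norm_num)
  exact ⟨fun t => (d1 t).hasDerivAt, fun t => (d2 t).hasDerivAt⟩

/-- (Lemma B.6: particular solutions of `𝓛_i φ = tᵐ e^{-γt} h(t)`.) -/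
theorem statement_19 (n : ℕ) (hn : 3 ≤ n) (a b p : ℝ)
    (ha0 : 0 ≤ a) (ha : a < ((n : ℝ) - 2) / 2) (hab : a ≤ b) (hb : b < a + 1)
    (hp : p = 2 * (n : ℝ) / ((n : ℝ) - 2 + 2 * (b - a)))
    (ζ : ℝ → ℝ) (T : ℝ) (hζ : ZetaSol n a p ζ T)
    (σ : ℕ → ℝ) (hσ : CKNExponents n a p ζ T σ)
    (γ : ℝ) (hγ : 0 < γ) (m : ℕ)
    (h : ℝ → ℝ) (hh : ContDiff ℝ (⊤ : ℕ∞) h) (hhper : Function.Periodic h T) :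
    ∀ i : ℕ, ∃ φ : ℝ → ℝ,
      (∀ t, LopCKN n a p ζ (sphEval n i) φ t = t ^ m * Real.exp (-γ * t) * h t) ∧
      (γ ≠ σ i → ∃ r : ℕ → ℝ → ℝ,
        (∀ j, j ≤ m → ContDiff ℝ (⊤ : ℕ∞) (r j) ∧ Function.Periodic (r j) T) ∧
        ∀ t, φ t = Real.exp (-γ * t) * ∑ j ∈ Finset.range (m + 1), t ^ j * r j t) ∧
      (γ = σ i → ∃ r : ℕ → ℝ → ℝ,
        (∀ j, j ≤ m + 1 → ContDiff ℝ (⊤ : ℕ∞) (r j) ∧ Function.Periodic (r j) T) ∧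
        ∀ t, φ t = Real.exp (-γ * t) * ∑ j ∈ Finset.range (m + 2), t ^ j * r j t) := by
  obtain ⟨hζ2, hpos, hT, hper, heq⟩ := hζ
  set c : ℝ := ((n : ℝ) - 2 * a - 2) ^ 2 / 4 with hc
  have hc0 : 0 ≤ c := by positivity
  have hp2 : 2 ≤ p := by
    have hn' : (3 : ℝ) ≤ n := by exact_mod_cast hn
    rw [hp, le_div_iff₀ (by linarith)]
    linarith
  have hζs : ContDiff ℝ (⊤ : ℕ∞) ζ := zeta_smooth (c := c) (p := p) hζ2 hpos fun t => by
    have := heq t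
    rw [dtt] at this
    linarith
  have hVs : ∀ lam : ℝ, SP T (fun t => lam + c - (p - 1) * ζ t ^ (p - 2)) := fun lam =>
    ⟨contDiff_const.sub (contDiff_const.mul (hζs.rpow_const_of_ne fun t => (hpos t).ne')),
      fun t => by simp only [hper t]⟩
  have hhs : SP T h := ⟨hh, hhper⟩
  have main : ∀ i, ∃ φ, (γ ≠ σ i → Good T (fun t => sphEval n i + c - (p - 1) * ζ t ^ (p - 2)) γ m h m φ) ∧
      (γ = σ i → Good T (fun t => sphEval n i + c - (p - 1) * ζ t ^ (p - 2)) γ m h (m + 1) φ) := by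
    intro i
    rcases Nat.eq_zero_or_pos i with rfl | hi
    · have : ∃ φ, Good T (fun t => sphEval n 0 + c - (p - 1) * ζ t ^ (p - 2)) γ m h m φ := by
        have hζ1s : ContDiff ℝ (⊤ : ℕ∞) (deriv ζ) := (contDiff_infty_iff_deriv.1 hζs).2
        have hζ2s : ContDiff ℝ (⊤ : ℕ∞) (deriv (deriv ζ)) := (contDiff_infty_iff_deriv.1 hζ1s).2
        have hd0 : ∀ t, HasDerivAt ζ (deriv ζ t) t := fun t =>
          ((contDiff_infty_iff_deriv.1 hζs).1 t).hasDerivAt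
        have hd1 : ∀ t, HasDerivAt (deriv ζ) (deriv (deriv ζ) t) t := fun t =>
          ((contDiff_infty_iff_deriv.1 hζ1s).1 t).hasDerivAt
        have pd : ∀ {f : ℝ → ℝ}, Function.Periodic f T → Function.Periodic (deriv f) T := fun {f} hf t => by
          rw [← deriv_comp_add_const]
          congr 1
          exact funext hf
        have hdd : deriv (deriv ζ) = fun t => c * ζ t - ζ t ^ (p - 1) := funext fun t => by
          have := heq t
          rw [dtt] at this
          linarith
        by_cases hnz : ∃ t, deriv ζ t ≠ 0
        · refine case_zero hT (hVs _) hγ m hhs ⟨hζ1s, pd hper⟩ ⟨hζ2s, pd (pd hper)⟩ hd1 (fun t => ?_) hnz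
          rw [hdd]
          refine HasDerivAt.congr_deriv
            (((hd0 t).const_mul c).sub ((hd0 t).rpow_const (p := p - 1) (Or.inl (hpos t).ne'))) ?_
          rw [sphEval_zero n hn, show p - 1 - 1 = p - 2 by ring]
          ring
        · push Not at hnz
          refine case_const hT (ω := Real.sqrt ((p - 2) * c)) (fun t => ?_) hγ m hhs
          have h1 : deriv (deriv ζ) t = 0 := by
            rw [show deriv ζ = fun _ => 0 from funext hnz]; simp
          rw [hdd] at h1
          simp only at h1
          have h2 : ζ t ^ (p - 1) = ζ t ^ (p - 2) * ζ t := by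
            rw [← Real.rpow_add_one (hpos t).ne']; ring_nf
          have h3 : ζ t ^ (p - 2) = c := by
            have : (c - ζ t ^ (p - 2)) * ζ t = 0 := by linear_combination h1 + h2
            rcases mul_eq_zero.1 this with h | h
            · linarith
            · exact absurd h (hpos t).ne'
          rw [Real.sq_sqrt (mul_nonneg (by linarith) hc0), sphEval_zero n hn, h3]
          ring
      obtain ⟨φ, hφ⟩ := this
      exact ⟨φ, fun _ => hφ, fun _ => hφ.mono⟩
    · obtain ⟨hσ0, -, -, hker⟩ := hσ
      obtain ⟨q₁, q₂, hq₁, hq₂, hp₁, hp₂, hk1, hk2, hL1, hL2, hli, -⟩ := hker i hi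
      obtain ⟨a1, a2⟩ := derivs_of_C2 hk1
      obtain ⟨b1, b2⟩ := derivs_of_C2 hk2
      refine case_pos hT (hVs _).1.continuous (hVs _).2 (hσ0 i hi) hγ m hhs ⟨hq₁, hp₁⟩ ⟨hq₂, hp₂⟩
        (fun t => rfl) (fun t => rfl) a1 (fun t => (a2 t).congr_deriv ?_) b1
        (fun t => (b2 t).congr_deriv ?_) hli
      · have := hL1 t
        simp only [LopCKN, ← hc] at this
        linarith
      · have := hL2 t
        simp only [LopCKN, ← hc] at this
        linarith
  intro i
  obtain ⟨φ, h1, h2⟩ := main i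
  refine ⟨φ, ?_, fun h => (h1 h).final.2, fun h => (h2 h).final.2⟩
  by_cases hg : γ = σ i
  · exact (h2 hg).final.1
  · exact (h1 hg).final.1
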